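/- Let k ∈ ℤ with k ≤ 0 and let f : ℍ → ℂ be smooth with Δ_k f = 0. Then applying the raising operator (−k) times followed by the lowering operator (−k) times recovers f up to a factorial constant: L_{−k}^{−k}(R_k^{−k} f) = ((−k)!)² · f. -/

import Mathlib

open Complex

noncomputable section

/-- The upper half-plane, as a subset of `ℂ`. -/
def UH : Set ℂ := {z : ℂ | 0 < z.im}

/-- Partial derivative in the direction of the real axis, `∂f/∂u`. -/
noncomputable def du (f : ℂ → ℂ) (z : ℂ) : ℂ := fderiv ℝ f z 1

/-- Partial derivative in the direction of the imaginary axis, `∂f/∂v`. -/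
noncomputable def dv (f : ℂ → ℂ) (z : ℂ) : ℂ := fderiv ℝ f z Complex.I

/-- The Wirtinger derivative `∂_τ f = (1/2)(∂f/∂u − i ∂f/∂v)`. -/
noncomputable def dtau (f : ℂ → ℂ) (z : ℂ) : ℂ :=
  (1 / 2) * (du f z - Complex.I * dv f z)

/-- The Wirtinger derivative `∂_τ̄ f = (1/2)(∂f/∂u + i ∂f/∂v)`. -/
noncomputable def dtauBar (f : ℂ → ℂ) (z : ℂ) : ℂ :=
  (1 / 2) * (du f z + Complex.I * dv f z)

/-- The Maass raising operator `R_k f = 2i ∂_τ f + (k/v) f`. -/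
noncomputable def Rop (k : ℤ) (f : ℂ → ℂ) (z : ℂ) : ℂ :=
  2 * Complex.I * dtau f z + ((k : ℂ) / (z.im : ℂ)) * f z

/-- The Maass lowering operator `L_k f = −2i v² ∂_τ̄ f`. -/
noncomputable def Lop (_k : ℤ) (f : ℂ → ℂ) (z : ℂ) : ℂ :=
  -2 * Complex.I * (z.im : ℂ) ^ 2 * dtauBar f z

/-- The weight-`k` hyperbolic Laplacian
`Δ_k f = −v²(∂²f/∂u² + ∂²f/∂v²) + i k v (∂f/∂u + i ∂f/∂v)`. -/
noncomputable def Lap (k : ℤ) (f : ℂ → ℂ) (z : ℂ) : ℂ :=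
  -(z.im : ℂ) ^ 2 * (du (du f) z + dv (dv f) z)
    + Complex.I * (k : ℂ) * (z.im : ℂ) * (du f z + Complex.I * dv f z)

/-- Iterated raising operator `R_k^r = R_{k+2(r−1)} ∘ ⋯ ∘ R_{k+2} ∘ R_k`, `R_k^0 = id`. -/
noncomputable def Riter (k : ℤ) : ℕ → (ℂ → ℂ) → ℂ → ℂ
  | 0, f => f
  | r + 1, f => Rop (k + 2 * (r : ℤ)) (Riter k r f)

/-- Iterated lowering operator `L_k^r = L_{k−2(r−1)} ∘ ⋯ ∘ L_{k−2} ∘ L_k`, `L_k^0 = id`. -/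
noncomputable def Liter (k : ℤ) : ℕ → (ℂ → ℂ) → ℂ → ℂ
  | 0, f => f
  | r + 1, f => Lop (k - 2 * (r : ℤ)) (Liter k r f)

theorem isOpen_UH : IsOpen UH := isOpen_lt continuous_const Complex.continuous_im

theorem contDiffOn_fderiv_apply {f : ℂ → ℂ} (hf : ContDiffOn ℝ (⊤ : ℕ∞) f UH) (w : ℂ) :
    ContDiffOn ℝ (⊤ : ℕ∞) (fun z => fderiv ℝ f z w) UH :=
  (hf.fderiv_of_isOpen isOpen_UH (by simp)).clm_apply contDiffOn_const

theorem contDiffOn_du {f : ℂ → ℂ} (hf : ContDiffOn ℝ (⊤ : ℕ∞) f UH) :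
    ContDiffOn ℝ (⊤ : ℕ∞) (du f) UH :=
  contDiffOn_fderiv_apply hf 1

theorem contDiffOn_dv {f : ℂ → ℂ} (hf : ContDiffOn ℝ (⊤ : ℕ∞) f UH) :
    ContDiffOn ℝ (⊤ : ℕ∞) (dv f) UH :=
  contDiffOn_fderiv_apply hf Complex.I

theorem im_ne_zero_of_mem_UH {z : ℂ} (hz : z ∈ UH) : (z.im : ℂ) ≠ 0 :=
  Complex.ofReal_ne_zero.2 (ne_of_gt hz)

theorem contDiff_ofReal_im : ContDiff ℝ (⊤ : ℕ∞) (fun z : ℂ => (z.im : ℂ)) :=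
  (Complex.ofRealCLM.comp Complex.imCLM).contDiff

theorem contDiffOn_Rop (k : ℤ) {f : ℂ → ℂ} (hf : ContDiffOn ℝ (⊤ : ℕ∞) f UH) :
    ContDiffOn ℝ (⊤ : ℕ∞) (Rop k f) UH := by
  have hdiv : ContDiffOn ℝ (⊤ : ℕ∞) (fun z : ℂ => (k : ℂ) / (z.im : ℂ)) UH := by
    simp only [div_eq_mul_inv]
    exact contDiffOn_const.mul
      (contDiff_ofReal_im.contDiffOn.inv fun z hz => im_ne_zero_of_mem_UH hz)
  exact (contDiffOn_const.mul (contDiffOn_const.mul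
    ((contDiffOn_du hf).sub (contDiffOn_const.mul (contDiffOn_dv hf))))).add (hdiv.mul hf)

theorem contDiffOn_Riter (k : ℤ) {f : ℂ → ℂ} (hf : ContDiffOn ℝ (⊤ : ℕ∞) f UH) (r : ℕ) :
    ContDiffOn ℝ (⊤ : ℕ∞) (Riter k r f) UH := by
  induction r with
  | zero => exact hf
  | succ r ih => exact contDiffOn_Rop _ ih

theorem hasFDerivAt_of_contDiffOn_UH {f : ℂ → ℂ} (hf : ContDiffOn ℝ (⊤ : ℕ∞) f UH) {z : ℂ}
    (hz : z ∈ UH) : HasFDerivAt f (fderiv ℝ f z) z :=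
  ((hf.contDiffAt (isOpen_UH.mem_nhds hz)).differentiableAt (by simp)).hasFDerivAt

/-- Mixed partial derivatives commute. -/
theorem du_dv_comm {f : ℂ → ℂ} (hf : ContDiffOn ℝ (⊤ : ℕ∞) f UH) {z : ℂ} (hz : z ∈ UH) :
    du (dv f) z = dv (du f) z := by
  have hfz := hf.contDiffAt (isOpen_UH.mem_nhds hz)
  have hd : DifferentiableAt ℝ (fderiv ℝ f) z :=
    ((hf.fderiv_of_isOpen (m := (⊤ : ℕ∞)) isOpen_UH (by simp)).contDiffAt
      (isOpen_UH.mem_nhds hz)).differentiableAt (by simp)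
  have hsymm := hfz.isSymmSndFDerivAt (by simpa using WithTop.coe_le_coe.2 (le_top : (2 : ℕ∞) ≤ ⊤))
  have key (w : ℂ) : fderiv ℝ (fun x => fderiv ℝ f x w) z
      = (fderiv ℝ (fderiv ℝ f) z).flip w := by
    rw [fderiv_clm_apply hd (differentiableAt_const _)]
    ext; simp
  change fderiv ℝ (fun x => fderiv ℝ f x Complex.I) z 1
    = fderiv ℝ (fun x => fderiv ℝ f x 1) z Complex.I
  rw [key, key]
  exact hsymm 1 Complex.I

theorem hasFDerivAt_ofReal_im (z : ℂ) :
    HasFDerivAt (fun z : ℂ => (z.im : ℂ)) (Complex.ofRealCLM.comp Complex.imCLM) z :=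
  (Complex.ofRealCLM.comp Complex.imCLM).hasFDerivAt

theorem hasFDerivAt_Rop (k : ℤ) {f : ℂ → ℂ} (hf : ContDiffOn ℝ (⊤ : ℕ∞) f UH) {z : ℂ}
    (hz : z ∈ UH) :
    HasFDerivAt (Rop k f)
      (Complex.I • fderiv ℝ (du f) z + fderiv ℝ (dv f) z
        + (((k : ℂ) / (z.im : ℂ)) • fderiv ℝ f z
          - ((k : ℂ) * f z / (z.im : ℂ) ^ 2) • Complex.ofRealCLM.comp Complex.imCLM)) z := by
  have hv := im_ne_zero_of_mem_UH hz
  have hinv := ((hasDerivAt_inv hv).hasFDerivAt.restrictScalars ℝ).comp z (hasFDerivAt_ofReal_im z)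
  have h := (((hasFDerivAt_of_contDiffOn_UH (contDiffOn_du hf) hz).const_mul Complex.I).add
    (hasFDerivAt_of_contDiffOn_UH (contDiffOn_dv hf) hz)).add
    ((hinv.mul (hasFDerivAt_of_contDiffOn_UH hf hz)).const_mul (k : ℂ))
  refine (h.congr_fderiv ?_).congr_of_eventuallyEq (Filter.Eventually.of_forall fun w => ?_)
  · ext w
    simp
    field_simp
    ring
  · simp [Rop, dtau]
    linear_combination (-dv f w) * Complex.I_sq

theorem hasFDerivAt_Lop (k : ℤ) {f : ℂ → ℂ} (hf : ContDiffOn ℝ (⊤ : ℕ∞) f UH) {z : ℂ}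
    (hz : z ∈ UH) :
    HasFDerivAt (Lop k f)
      ((z.im : ℂ) ^ 2 • (fderiv ℝ (dv f) z - Complex.I • fderiv ℝ (du f) z)
        + (2 * (z.im : ℂ) * (dv f z - Complex.I * du f z))
          • Complex.ofRealCLM.comp Complex.imCLM) z := by
  have h := ((hasFDerivAt_ofReal_im z).mul (hasFDerivAt_ofReal_im z)).mul
    ((hasFDerivAt_of_contDiffOn_UH (contDiffOn_dv hf) hz).sub
      ((hasFDerivAt_of_contDiffOn_UH (contDiffOn_du hf) hz).const_mul Complex.I))
  refine (h.congr_fderiv ?_).congr_of_eventuallyEq (Filter.Eventually.of_forall fun w => ?_)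
  · ext w
    simp
    ring
  · simp [Lop, dtauBar]
    linear_combination (-(w.im : ℂ) ^ 2 * dv f w) * Complex.I_sq

/-- `L_{k+2} ∘ R_k = -Δ_k - k`. -/
theorem Lop_Rop (l k : ℤ) {f : ℂ → ℂ} (hf : ContDiffOn ℝ (⊤ : ℕ∞) f UH) {z : ℂ} (hz : z ∈ UH) :
    Lop l (Rop k f) z = -Lap k f z - k * f z := by
  have hv := im_ne_zero_of_mem_UH hz
  have hcomm : fderiv ℝ (dv f) z 1 = fderiv ℝ (du f) z Complex.I := du_dv_comm hf hz
  have h := (hasFDerivAt_Rop k hf hz).fderiv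
  simp only [Lop, dtauBar, Lap]
  rw [du.eq_def (Rop k f), dv.eq_def (Rop k f), h, du.eq_def (du f), dv.eq_def (dv f)]
  simp [hcomm]
  simp only [← du.eq_def f, ← dv.eq_def f]
  field_simp
  ring_nf
  simp only [Complex.I_sq, Complex.I_pow_three]
  ring

/-- `R_{k-2} ∘ L_k = -Δ_k`. -/
theorem Rop_Lop (l k : ℤ) {f : ℂ → ℂ} (hf : ContDiffOn ℝ (⊤ : ℕ∞) f UH) {z : ℂ} (hz : z ∈ UH) :
    Rop (k - 2) (Lop l f) z = -Lap k f z := by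
  have hv := im_ne_zero_of_mem_UH hz
  have hcomm : fderiv ℝ (dv f) z 1 = fderiv ℝ (du f) z Complex.I := du_dv_comm hf hz
  have h := (hasFDerivAt_Lop l hf hz).fderiv
  simp only [Rop, dtau, Lap]
  rw [du.eq_def (Lop l f), dv.eq_def (Lop l f), h, du.eq_def (du f), dv.eq_def (dv f)]
  simp [hcomm, Lop, dtauBar]
  field_simp
  ring_nf
  simp only [Complex.I_sq, Complex.I_pow_three]
  ring

theorem fderiv_congr_const_mul {f g : ℂ → ℂ} (hg : ContDiffOn ℝ (⊤ : ℕ∞) g UH) {c : ℂ}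
    (h : ∀ z ∈ UH, f z = c * g z) {z : ℂ} (hz : z ∈ UH) :
    fderiv ℝ f z = c • fderiv ℝ g z :=
  (((hasFDerivAt_of_contDiffOn_UH hg hz).const_mul c).congr_of_eventuallyEq
    (Filter.eventually_of_mem (isOpen_UH.mem_nhds hz) h)).fderiv

theorem Lop_congr_const_mul (l m : ℤ) {f g : ℂ → ℂ} (hg : ContDiffOn ℝ (⊤ : ℕ∞) g UH) {c : ℂ}
    (h : ∀ z ∈ UH, f z = c * g z) {z : ℂ} (hz : z ∈ UH) :
    Lop l f z = c * Lop m g z := by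
  simp only [Lop, dtauBar, du, dv, fderiv_congr_const_mul hg h hz, smul_apply, smul_eq_mul]
  ring

theorem Rop_congr_const_mul (k : ℤ) {f g : ℂ → ℂ} (hg : ContDiffOn ℝ (⊤ : ℕ∞) g UH) {c : ℂ}
    (h : ∀ z ∈ UH, f z = c * g z) {z : ℂ} (hz : z ∈ UH) :
    Rop k f z = c * Rop k g z := by
  simp only [Rop, dtau, du, dv, fderiv_congr_const_mul hg h hz, h z hz, smul_apply, smul_eq_mul]
  ring

/-- On harmonic `f` of weight `k`, lowering undoes one raising step up to a scalar. -/
theorem Lop_Riter_succ (k l : ℤ) {f : ℂ → ℂ} (hf : ContDiffOn ℝ (⊤ : ℕ∞) f UH)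
    (hharm : ∀ z ∈ UH, Lap k f z = 0) (r : ℕ) :
    ∀ z ∈ UH, Lop l (Riter k (r + 1) f) z = ((r + 1) * (-k - r) : ℂ) * Riter k r f z := by
  induction r with
  | zero =>
    intro z hz
    simp [Riter, Lop_Rop l k hf hz, hharm z hz]
  | succ r ih =>
    intro z hz
    have hg := contDiffOn_Riter k hf (r + 1)
    have hR : Rop (k + 2 * r) (Lop l (Riter k (r + 1) f)) z
        = -Lap (k + 2 * (r + 1 : ℕ)) (Riter k (r + 1) f) z := by
      rw [← Rop_Lop l _ hg hz]
      congr 1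
      push_cast
      ring
    rw [Rop_congr_const_mul _ (contDiffOn_Riter k hf r) ih hz] at hR
    change Lop l (Rop (k + 2 * (r + 1 : ℕ)) (Riter k (r + 1) f)) z = _
    rw [Lop_Rop l _ hg hz, ← hR]
    change _ * Riter k (r + 1) f z - _ = _
    push_cast
    ring

theorem Liter_Riter_add (k l : ℤ) {f : ℂ → ℂ} (hf : ContDiffOn ℝ (⊤ : ℕ∞) f UH)
    (hharm : ∀ z ∈ UH, Lap k f z = 0) (s r : ℕ) :
    ∀ z ∈ UH, Liter l s (Riter k (r + s) f) z
      = (∏ j ∈ Finset.range s, ((r + j + 1) * (-k - r - j) : ℂ)) * Riter k r f z := by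
  induction s generalizing r with
  | zero => simp [Liter]
  | succ s ih =>
    intro z hz
    have h := ih (r + 1)
    rw [show r + 1 + s = r + (s + 1) by ring] at h
    change Lop _ (Liter l s _) z = _
    rw [Lop_congr_const_mul _ l (contDiffOn_Riter k hf (r + 1)) h hz,
      Lop_Riter_succ k l hf hharm r z hz, Finset.prod_range_succ', ← mul_assoc]
    congr 2
    · refine Finset.prod_congr rfl fun j _ => ?_
      push_cast
      ring
    · push_cast
      ring

theorem prod_range_succ_mul_sub (n : ℕ) :
    ∏ j ∈ Finset.range n, ((j + 1) * (n - j) : ℂ) = (n.factorial : ℂ) ^ 2 := by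
  have h₁ : ∏ j ∈ Finset.range n, (j + 1 : ℂ) = n.factorial := by
    rw [← Finset.prod_range_add_one_eq_factorial]
    push_cast
    rfl
  have h₂ : ∏ j ∈ Finset.range n, (n - j : ℂ) = n.factorial := by
    rw [← h₁, ← Finset.prod_range_reflect]
    refine Finset.prod_congr rfl fun j hj => ?_
    have := Finset.mem_range.1 hj
    rw [Nat.sub_sub, Nat.cast_sub (by omega)]
    push_cast
    ring
  rw [Finset.prod_mul_distrib, h₁, h₂, sq]

/-- if `k ≤ 0` and `Δ_k f = 0` then
`L_{−k}^{−k}(R_k^{−k} f) = ((−k)!)² f`. -/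
theorem stmt8 (k : ℤ) (hk : k ≤ 0) (f : ℂ → ℂ) (hf : ContDiffOn ℝ (⊤ : ℕ∞) f UH)
    (hharm : ∀ z ∈ UH, Lap k f z = 0) :
    ∀ z ∈ UH,
      Liter (-k) (-k).toNat (Riter k (-k).toNat f) z
        = (((-k).toNat.factorial : ℂ)) ^ 2 * f z := by
  intro z hz
  obtain ⟨n, rfl⟩ : ∃ n : ℕ, k = -n := ⟨(-k).toNat, by omega⟩
  have h := Liter_Riter_add (-n) (- -n) hf hharm n 0 z hz
  simp only [neg_neg, Int.toNat_natCast, zero_add] at h ⊢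
  rw [h, ← prod_range_succ_mul_sub]
  simp [Riter]
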